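/- For each fixed m ≥ 1, the leading coefficient of the quasi-polynomial f_m(n) (the coefficient of n^{m-1}) is the same constant for every residue class; i.e., the degree-(m-1) part of f_m(n) is a genuine polynomial term independent of n mod N. -/

import Mathlib

/-- A partition has pairwise distinct (nonzero) multiplicities. -/
def distinctMult {n : ℕ} (P : n.Partition) : Prop :=
  ∀ i ∈ P.parts, ∀ j ∈ P.parts, i ≠ j → P.parts.count i ≠ P.parts.count j

/-- `fm m n` : the number of partitions of `n` with all parts at most `m` and all nonzero
multiplicities pairwise distinct. -/
noncomputable def fm (m n : ℕ) : ℕ :=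
  Nat.card {P : n.Partition // (∀ x ∈ P.parts, x ≤ m) ∧ distinctMult P}

open Polynomial in
/-- Shifting the variable keeps degree bound and top coefficient. -/
lemma shift_poly (P : ℚ[X]) (d : ℕ) (s : ℚ) (h : P.natDegree ≤ d) :
    (P.comp (X + C s)).natDegree ≤ d ∧ (P.comp (X + C s)).coeff d = P.coeff d := by
  rw [← taylor_apply]
  refine ⟨by rw [natDegree_taylor]; exact h, ?_⟩
  rcases h.lt_or_eq with h1 | h1
  · rw [coeff_eq_zero_of_natDegree_lt h1, coeff_eq_zero_of_natDegree_lt]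
    rw [natDegree_taylor]; exact h1
  · subst h1
    rw [coeff_taylor_natDegree]; rfl

open Polynomial in
lemma step_poly (M : ℚ) (hM : M ≠ 0) (d : ℕ) (Q : ℚ[X]) (hQ : Q.degree < (d + 1 : ℕ)) :
    (Q - ((C (Q.coeff d / (M * (d + 1))) * X ^ (d + 1)).comp (X + C M)
      - C (Q.coeff d / (M * (d + 1))) * X ^ (d + 1))).degree < (d : WithBot ℕ) := by
  rw [degree_lt_iff_coeff_zero] at hQ ⊢
  intro k hk
  have hd : (d : ℚ) + 1 ≠ 0 := by positivity
  simp only [mul_comp, C_comp, pow_comp, X_comp, coeff_sub, coeff_C_mul, coeff_X_add_C_pow,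
    coeff_X_pow]
  rcases hk.eq_or_lt with h | h
  · subst h
    simp
    field_simp
    ring
  · rw [hQ k h]
    rcases (Nat.succ_le_of_lt h).eq_or_lt with h | h
    · subst h; simp
    · rw [Nat.choose_eq_zero_of_lt h, if_neg (by omega)]; simp

open Polynomial in
lemma antidiff_aux (M : ℚ) (hM : M ≠ 0) (d : ℕ) : ∀ (Q : ℚ[X]), Q.degree < d →
    ∃ R : ℚ[X], R.natDegree ≤ d ∧ R.comp (X + C M) - R = Q := by
  induction d with
  | zero =>
    intro Q hQ
    refine ⟨0, by simp, ?_⟩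
    have : Q = 0 := by
      rw [← degree_eq_bot]
      simpa using hQ
    simp [this]
  | succ d ih =>
    intro Q hQ
    obtain ⟨R, h1, h2⟩ := ih _ (step_poly M hM d Q hQ)
    refine ⟨R + C (Q.coeff d / (M * (d + 1))) * X ^ (d + 1), ?_, ?_⟩
    · exact natDegree_add_le_of_degree_le (by omega) (natDegree_C_mul_X_pow_le _ _)
    · rw [add_comp]
      linear_combination h2

open Polynomial in
lemma antidiff (M : ℚ) (hM : M ≠ 0) (d : ℕ) (Q : ℚ[X]) (hQ : Q.natDegree ≤ d) :
    ∃ R : ℚ[X], R.natDegree ≤ d + 1 ∧ R.coeff (d + 1) = Q.coeff d / (M * (d + 1)) ∧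
      R.comp (X + C M) - R = Q := by
  have hQ' : Q.degree < (d + 1 : ℕ) :=
    lt_of_le_of_lt (natDegree_le_iff_degree_le.1 hQ) (by exact_mod_cast Nat.lt_succ_self d)
  obtain ⟨R, h1, h2⟩ := antidiff_aux M hM d _ (step_poly M hM d Q hQ')
  refine ⟨R + C (Q.coeff d / (M * (d + 1))) * X ^ (d + 1), ?_, ?_, ?_⟩
  · exact natDegree_add_le_of_degree_le (by omega) (natDegree_C_mul_X_pow_le _ _)
  · rw [coeff_add, coeff_eq_zero_of_natDegree_lt (by omega : R.natDegree < d + 1)]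
    simp
  · rw [add_comp]
    linear_combination h2

open Polynomial in
/-- Eventually quasi-polynomial of degree at most `d`, with coefficient of `n^d` equal to `c`
on every residue class. -/
def QP (d : ℕ) (c : ℚ) (f : ℕ → ℚ) : Prop :=
  ∃ N : ℕ, 0 < N ∧ ∃ n₀ : ℕ, ∀ n ≥ n₀, ∃ P : ℚ[X], P.natDegree ≤ d ∧ P.coeff d = c ∧
    ∀ k : ℕ, f (n + k * N) = P.eval ((n + k * N : ℕ) : ℚ)

lemma QP.sub {d : ℕ} {c c' : ℚ} {f g : ℕ → ℚ} (hf : QP d c f) (hg : QP d c' g) :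
    QP d (c - c') (fun n => f n - g n) := by
  obtain ⟨N, hN, n₀, h⟩ := hf
  obtain ⟨N', hN', n₀', h'⟩ := hg
  refine ⟨N * N', Nat.mul_pos hN hN', max n₀ n₀', fun n hn => ?_⟩
  obtain ⟨P, h1, h2, h3⟩ := h n (le_trans (le_max_left _ _) hn)
  obtain ⟨P', h1', h2', h3'⟩ := h' n (le_trans (le_max_right _ _) hn)
  refine ⟨P - P', Polynomial.natDegree_sub_le_of_le h1 h1' |>.trans (by simp), by simp [h2, h2'],
    fun k => ?_⟩
  have e1 := h3 (k * N')
  have e2 := h3' (k * N)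
  rw [show k * N' * N = k * (N * N') by ring] at e1
  rw [show k * N * N' = k * (N * N') by ring] at e2
  rw [Polynomial.eval_sub, ← e1, ← e2]

lemma QP.succ {d : ℕ} {c : ℚ} {f : ℕ → ℚ} (hf : QP d c f) : QP (d + 1) 0 f := by
  obtain ⟨N, hN, n₀, h⟩ := hf
  refine ⟨N, hN, n₀, fun n hn => ?_⟩
  obtain ⟨P, h1, h2, h3⟩ := h n hn
  exact ⟨P, by omega, Polynomial.coeff_eq_zero_of_natDegree_lt (by omega), h3⟩

lemma QP.mono {d e : ℕ} {f : ℕ → ℚ} (hf : QP d 0 f) (h : d ≤ e) : QP e 0 f := by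
  induction e, h using Nat.le_induction with
  | base => exact hf
  | succ e _ ih => exact ih.succ

lemma QP.unshift {d : ℕ} {c : ℚ} {f : ℕ → ℚ} (s : ℕ) (hf : QP d c (fun n => f (n + s))) :
    QP d c f := by
  obtain ⟨N, hN, n₀, h⟩ := hf
  refine ⟨N, hN, n₀ + s, fun n hn => ?_⟩
  obtain ⟨n, rfl⟩ : ∃ t, n = t + s := ⟨n - s, by omega⟩
  obtain ⟨P, h1, h2, h3⟩ := h n (by omega)
  obtain ⟨a, b⟩ := shift_poly P d (-(s : ℚ)) h1
  refine ⟨_, a, b.trans h2, fun k => ?_⟩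
  have : f (n + k * N + s) = _ := h3 k
  rw [show n + s + k * N = n + k * N + s by ring, this]
  simp

lemma QP.step {d : ℕ} {c : ℚ} {g h : ℕ → ℚ} (a : ℕ) (ha : 0 < a) (hg : QP d c g)
    (H : ∀ n, h (n + a) = g (n + a) + h n) : QP (d + 1) (c / (a * (d + 1))) h := by
  obtain ⟨N, hN, n₀, hP⟩ := hg
  have H' : ∀ k n, h (n + a * k) = h n + ∑ i ∈ Finset.range k, g (n + a * (i + 1)) := by
    intro k n
    induction k with
    | zero => simp
    | succ k ih =>
      rw [Finset.sum_range_succ, show n + a * (k + 1) = n + a * k + a by ring, H, ih]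
      ring
  have haQ : (a : ℚ) ≠ 0 := by positivity
  have hNQ : (N : ℚ) ≠ 0 := by positivity
  refine ⟨a * N, Nat.mul_pos ha hN, n₀, fun n hn => ?_⟩
  have hP' : ∀ i : ℕ, ∃ P : Polynomial ℚ, P.natDegree ≤ d ∧ P.coeff d = c ∧
    ∀ k : ℕ, g (n + k * N + a * (i + 1)) = P.eval ((n + k * N : ℕ) : ℚ) := by
    intro i
    obtain ⟨P, h1, h2, h3⟩ := hP (n + a * (i + 1)) (by omega)
    obtain ⟨u, v⟩ := shift_poly P d (a * (i + 1)) h1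
    refine ⟨_, u, v.trans h2, fun k => ?_⟩
    rw [show n + k * N + a * (i + 1) = n + a * (i + 1) + k * N by ring, h3]
    simp
    congr 1
    ring
  choose P h1 h2 h3 using hP'
  obtain ⟨R, r1, r2, r3⟩ := antidiff (a * N : ℚ) (by positivity) d
    (∑ i ∈ Finset.range N, P i) (Polynomial.natDegree_sum_le_of_forall_le _ _ (fun i _ => h1 i))
  refine ⟨R + Polynomial.C (h n - R.eval (n : ℚ)), ?_, ?_, ?_⟩
  · exact Polynomial.natDegree_add_le_of_degree_le r1 (by simp)
  · rw [Polynomial.coeff_add, r2, Polynomial.finsetSum_coeff]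
    simp only [h2, Polynomial.coeff_C_succ]
    simp
    field_simp
  · intro k
    induction k with
    | zero => simp
    | succ k ih =>
      rw [show n + (k + 1) * (a * N) = n + k * (a * N) + a * N by ring, H', ih]
      have e := congrArg (Polynomial.eval ((n + k * (a * N) : ℕ) : ℚ)) r3
      rw [Polynomial.eval_finsetSum] at e
      have e2 : ∀ i, g (n + k * (a * N) + a * (i + 1))
          = (P i).eval ((n + k * (a * N) : ℕ) : ℚ) := by
        intro i
        rw [← mul_assoc]
        exact h3 i (k * a)
      simp only [e2, ← e]
      simp
      ring

/-! ### Counting -/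

/-- Vectors of weight `n` supported in `s`. -/
def sol {κ : Type} [Fintype κ] (w : κ → ℕ) (s : Finset κ) (n : ℕ) : Set (κ → ℕ) :=
  {y | (∀ k, k ∉ s → y k = 0) ∧ ∑ k, w k * y k = n}

lemma weight_finite {κ : Type} [Fintype κ] (w : κ → ℕ) (hw : ∀ k, 0 < w k) (n : ℕ) :
    {y : κ → ℕ | ∑ k, w k * y k = n}.Finite := by
  apply (Set.Finite.pi' (fun _ : κ => Set.finite_Iic n)).subset
  intro y hy k
  have h1 : w k * y k ≤ ∑ k, w k * y k :=
    Finset.single_le_sum (f := fun k => w k * y k) (fun _ _ => Nat.zero_le _) (Finset.mem_univ k)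
  have h2 : y k ≤ w k * y k := Nat.le_mul_of_pos_left _ (hw k)
  have h3 : ∑ k, w k * y k = n := hy
  exact Set.mem_Iic.2 (by omega)

lemma sol_finite {κ : Type} [Fintype κ] (w : κ → ℕ) (hw : ∀ k, 0 < w k) (s : Finset κ) (n : ℕ) :
    (sol w s n).Finite := (weight_finite w hw n).subset (fun _ h => h.2)

lemma weight_add {κ : Type} [Fintype κ] (w y z : κ → ℕ) :
    ∑ k, w k * (y + z) k = ∑ k, w k * y k + ∑ k, w k * z k := by
  simp [mul_add, Finset.sum_add_distrib]

lemma sol_rec {κ : Type} [Fintype κ] [DecidableEq κ] (w : κ → ℕ) (hw : ∀ k, 0 < w k)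
    (s : Finset κ) (a : κ) (ha : a ∉ s) (n : ℕ) :
    (sol w (insert a s) (n + w a)).ncard
      = (sol w s (n + w a)).ncard + (sol w (insert a s) n).ncard := by
  have hsum : ∑ k, w k * (Pi.single a 1 : κ → ℕ) k = w a := by
    simp [Pi.single_apply]
  have hinj : Function.Injective (fun y : κ → ℕ => y + Pi.single a 1) := add_left_injective _
  rw [← Set.ncard_image_of_injective (sol w (insert a s) n) hinj,
    ← Set.ncard_union_eq ?_ (sol_finite w hw _ _) ((sol_finite w hw _ _).image _)]
  · congr 1
    ext y
    constructor
    · rintro ⟨h1, h2⟩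
      by_cases hy : y a = 0
      · left
        refine ⟨fun k hk => ?_, h2⟩
        by_cases hka : k = a
        · rw [hka, hy]
        · exact h1 k (by simp [hka, hk])
      · right
        have he : y = (y - Pi.single a 1) + Pi.single a 1 := by
          ext k
          by_cases hka : k = a
          · subst hka; simp; omega
          · simp [hka]
        refine ⟨y - Pi.single a 1, ⟨fun k hk => ?_, ?_⟩, he.symm⟩
        · simp [h1 k hk]
        · rw [he, weight_add, hsum] at h2
          omega
    · rintro (⟨h1, h2⟩ | ⟨z, ⟨h1, h2⟩, rfl⟩)
      · exact ⟨fun k hk => h1 k (fun h => hk (Finset.mem_insert_of_mem h)), h2⟩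
      · refine ⟨fun k hk => ?_, ?_⟩
        · have : k ≠ a := fun h => hk (by simp [h])
          simp [h1 k hk, this]
        · rw [weight_add, hsum, h2]
  · rw [Set.disjoint_left]
    rintro y ⟨h1, _⟩ ⟨z, _, rfl⟩
    have := h1 a ha
    simp at this

lemma sol_empty {κ : Type} [Fintype κ] (w : κ → ℕ) : QP 0 0 (fun n => ((sol w ∅ n).ncard : ℚ)) := by
  refine ⟨1, one_pos, 1, fun n hn => ⟨0, by simp, by simp, fun k => ?_⟩⟩
  have : sol w ∅ (n + k * 1) = ∅ := by
    ext y
    simp only [sol, Set.mem_ofPred_eq, Set.mem_empty_iff_false, iff_false, not_and]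
    intro h
    simp at h
    simp [h]
    omega
  simp only [this]; simp

lemma sol_QP {κ : Type} [Fintype κ] [DecidableEq κ] (w : κ → ℕ) (hw : ∀ k, 0 < w k)
    (s : Finset κ) : QP s.card 0 (fun n => ((sol w s n).ncard : ℚ)) := by
  induction s using Finset.induction_on with
  | empty => exact sol_empty w
  | insert a s ha ih =>
    rw [Finset.card_insert_of_notMem ha]
    have := ih.step (h := fun n => ((sol w (insert a s) n).ncard : ℚ)) (w a) (hw a)
      (fun n => by exact_mod_cast sol_rec w hw s a ha n)
    simpa using this

/-- If some weight is one, there is a constant nonzero leading coefficient. -/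
lemma sol_QP_main {κ : Type} [Fintype κ] [DecidableEq κ] (w : κ → ℕ) (hw : ∀ k, 0 < w k)
    (a : κ) (ha : w a = 1) (s : Finset κ) (hs : a ∉ s) :
    ∃ c : ℚ, c ≠ 0 ∧ QP s.card c (fun n => ((sol w (insert a s) n).ncard : ℚ)) := by
  induction s using Finset.induction_on with
  | empty =>
    refine ⟨1, one_ne_zero, 1, one_pos, 0, fun n _ => ⟨1, by simp, by simp, fun k => ?_⟩⟩
    have : sol w (insert a ∅) (n + k * 1) = {Pi.single a (n + k * 1)} := by
      ext y
      simp only [sol, Set.mem_ofPred_eq, Set.mem_singleton_iff]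
      constructor
      · rintro ⟨h1, h2⟩
        have h1' : ∀ k, k ≠ a → y k = 0 := fun k hk => h1 k (by simpa using hk)
        rw [Finset.sum_eq_single a (fun b _ hb => by simp [h1' b hb]) (by simp), ha] at h2
        ext k
        by_cases hk : k = a
        · subst hk; simp; omega
        · simp [hk, h1' k hk]
      · rintro rfl
        refine ⟨fun k hk => ?_, ?_⟩
        · have : k ≠ a := by simpa using hk
          simp [this]
        · simp [Pi.single_apply, ha]
    simp only [this]; simp
  | insert b s hb ih =>
    obtain ⟨c, hc, h⟩ := ih (fun h => hs (Finset.mem_insert_of_mem h))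
    have hwb := hw b
    have hba : b ∉ insert a s := by
      intro h
      rcases Finset.mem_insert.1 h with h | h
      · exact hs (by simp [h])
      · exact hb h
    refine ⟨c / (w b * (s.card + 1)), by positivity, ?_⟩
    rw [Finset.card_insert_of_notMem hb, Finset.insert_comm]
    exact h.step (w b) hwb (fun n => by exact_mod_cast sol_rec w hw _ b hba n)

lemma solZ_QP {κ : Type} [Fintype κ] (w : κ → ℕ) (hw : ∀ k, 0 < w k)
    (Z : Set κ) : QP (Fintype.card κ) 0
      (fun n => (({y : κ → ℕ | (∀ k ∈ Z, y k ≠ 0) ∧ ∑ k, w k * y k = n}).ncard : ℚ)) := by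
  classical
  let z : κ → ℕ := fun k => if k ∈ Z then 1 else 0
  apply QP.unshift (∑ k, w k * z k)
  have := sol_QP w hw Finset.univ
  rw [Finset.card_univ] at this
  convert this using 3 with n
  have hinj : Function.Injective (fun y : κ → ℕ => y + z) := add_left_injective _
  rw [← Set.ncard_image_of_injective (sol w Finset.univ n) hinj]
  congr 1
  ext y
  constructor
  · rintro ⟨h1, h2⟩
    have he : y = (y - z) + z := by
      ext k
      by_cases hk : k ∈ Z
      · have := h1 k hk
        simp [z, hk]; omega
      · simp [z, hk]
    refine ⟨y - z, ⟨by simp, ?_⟩, he.symm⟩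
    rw [he, weight_add] at h2
    omega
  · rintro ⟨y, ⟨_, h2⟩, rfl⟩
    refine ⟨fun k hk => by simp [z, hk], ?_⟩
    rw [weight_add, h2]

/-- Vectors with all equalities in `S` and none of the equalities in `E`. -/
def con {ι : Type} [Fintype ι] (w : ι → ℕ) (S E : Finset (ι × ι)) (n : ℕ) : Set (ι → ℕ) :=
  {x | (∀ e ∈ S, x e.1 = x e.2 ∧ x e.1 ≠ 0) ∧ (∀ e ∈ E, ¬ (x e.1 = x e.2 ∧ x e.1 ≠ 0)) ∧
    ∑ k, w k * x k = n}

lemma con_base {ι : Type} [Fintype ι] (w : ι → ℕ) (hw : ∀ k, 0 < w k) (S : Finset (ι × ι))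
    (e : ι × ι) (he : e ∈ S) (hne : e.1 ≠ e.2) :
    QP (Fintype.card ι - 1) 0 (fun n => ((con w S ∅ n).ncard : ℚ)) := by
  classical
  let r : ι → ι → Prop := fun i j => (i, j) ∈ S
  let π : ι → Quot r := Quot.mk r
  haveI : Fintype (Quot r) := Fintype.ofFinite _
  have hsurj : Function.Surjective π := Quot.mk_surjective
  have hcard : Fintype.card (Quot r) ≤ Fintype.card ι - 1 := by
    have : Fintype.card (Quot r) < Fintype.card ι := by
      apply Fintype.card_lt_of_surjective_not_injective π hsurj
      intro hinj
      exact hne (hinj (Quot.sound he))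
    omega
  let W : Quot r → ℕ := fun b => ∑ i with π i = b, w i
  have hW : ∀ b, 0 < W b := by
    intro b
    obtain ⟨i, hi⟩ := hsurj b
    exact Finset.sum_pos (fun i _ => hw i) ⟨i, by simp [hi]⟩
  have hsum : ∀ y : Quot r → ℕ, ∑ i, w i * y (π i) = ∑ b, W b * y b := by
    intro y
    rw [← Finset.sum_fiberwise Finset.univ π]
    refine Finset.sum_congr rfl (fun b _ => ?_)
    rw [Finset.sum_mul]
    refine Finset.sum_congr rfl (fun i hi => ?_)
    rw [(Finset.mem_filter.1 hi).2]
  have key := (solZ_QP W hW {b | ∃ e ∈ S, π e.1 = b}).mono hcard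
  convert key using 3 with n
  have hinj : Function.Injective (fun y : Quot r → ℕ => y ∘ π) := hsurj.injective_comp_right
  rw [← Set.ncard_image_of_injective _ hinj]
  congr 1
  ext x
  constructor
  · rintro ⟨h1, _, h2⟩
    refine ⟨Quot.lift x (fun i j hij => (h1 (i, j) hij).1), ⟨?_, ?_⟩, rfl⟩
    · rintro _ ⟨e, he, rfl⟩
      exact (h1 e he).2
    · rw [← hsum]; exact h2
  · rintro ⟨y, ⟨h1, h2⟩, rfl⟩
    refine ⟨fun e he => ⟨?_, h1 _ ⟨e, he, rfl⟩⟩, by simp, ?_⟩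
    · exact congrArg y (Quot.sound he)
    · rw [← h2, ← hsum]; rfl

lemma con_rec {ι : Type} [Fintype ι] [DecidableEq ι] (w : ι → ℕ) (hw : ∀ k, 0 < w k)
    (S E : Finset (ι × ι)) (e : ι × ι) (n : ℕ) :
    ((con w S (insert e E) n).ncard : ℚ)
      = (con w S E n).ncard - (con w (insert e S) E n).ncard := by
  have hfin : ∀ S E, (con w S E n).Finite := fun S E =>
    (weight_finite w hw n).subset (fun _ h => h.2.2)
  rw [eq_sub_iff_add_eq]
  norm_cast
  rw [← Set.ncard_union_eq _ (hfin _ _) (hfin _ _)]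
  · congr 1
    ext x
    simp only [con, Set.mem_union, Set.mem_ofPred_eq, Finset.forall_mem_insert]
    tauto
  · rw [Set.disjoint_left]
    rintro x ⟨_, h, _⟩ ⟨h', _⟩
    exact h e (by simp) (h' e (by simp))

lemma con_QP {ι : Type} [Fintype ι] [DecidableEq ι] (w : ι → ℕ) (hw : ∀ k, 0 < w k)
    (E : Finset (ι × ι)) : ∀ (S : Finset (ι × ι)) (e : ι × ι), e ∈ S → e.1 ≠ e.2 →
    QP (Fintype.card ι - 1) 0 (fun n => ((con w S E n).ncard : ℚ)) := by
  induction E using Finset.induction_on with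
  | empty => exact fun S e he hne => con_base w hw S e he hne
  | insert a E _ ih =>
    intro S e he hne
    simp only [con_rec w hw]
    simpa using (ih S e he hne).sub (ih (insert a S) e (Finset.mem_insert_of_mem he) hne)

lemma con_QP_main {ι : Type} [Fintype ι] [DecidableEq ι] (w : ι → ℕ) (hw : ∀ k, 0 < w k)
    (c : ℚ) (h0 : QP (Fintype.card ι - 1) c (fun n => ((con w ∅ ∅ n).ncard : ℚ)))
    (E : Finset (ι × ι)) : (∀ e ∈ E, e.1 ≠ e.2) →
    QP (Fintype.card ι - 1) c (fun n => ((con w ∅ E n).ncard : ℚ)) := by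
  induction E using Finset.induction_on with
  | empty => exact fun _ => h0
  | insert a E _ ih =>
    intro h
    simp only [con_rec w hw]
    simpa using (ih (fun e he => h e (Finset.mem_insert_of_mem he))).sub
      (con_QP w hw E (insert a ∅) a (by simp) (h a (by simp)))

/-- The multiset with multiplicities `x`. -/
def toM {m : ℕ} (x : Fin m → ℕ) : Multiset ℕ := ∑ i : Fin m, Multiset.replicate (x i) ((i : ℕ) + 1)

lemma toM_count {m : ℕ} (x : Fin m → ℕ) (j : Fin m) : (toM x).count ((j : ℕ) + 1) = x j := by
  simp [toM, Multiset.count_sum', Multiset.count_replicate, Fin.val_inj]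

lemma toM_mem {m : ℕ} (x : Fin m → ℕ) {a : ℕ} (h : a ∈ toM x) : ∃ j : Fin m, a = (j : ℕ) + 1 := by
  simp only [toM, Multiset.mem_sum, Finset.mem_univ, true_and] at h
  obtain ⟨i, hi⟩ := h
  exact ⟨i, Multiset.eq_of_mem_replicate hi⟩

lemma toM_sum {m : ℕ} (x : Fin m → ℕ) : (toM x).sum = ∑ i : Fin m, ((i : ℕ) + 1) * x i := by
  rw [toM, Multiset.sum_sum]
  simp [mul_comm]

lemma toM_of_count {m : ℕ} (s : Multiset ℕ) (h : ∀ a ∈ s, 0 < a ∧ a ≤ m) :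
    toM (fun i : Fin m => s.count ((i : ℕ) + 1)) = s := by
  ext a
  by_cases ha : 0 < a ∧ a ≤ m
  · obtain ⟨b, rfl⟩ : ∃ b, a = b + 1 := ⟨a - 1, by omega⟩
    exact toM_count (fun i : Fin m => s.count ((i : ℕ) + 1)) ⟨b, by omega⟩
  · rw [Multiset.count_eq_zero_of_notMem (fun h' => ha (h a h')),
      Multiset.count_eq_zero_of_notMem]
    intro h'
    obtain ⟨j, rfl⟩ := toM_mem _ h'
    exact ha ⟨by omega, by omega⟩

lemma fm_eq (m n : ℕ) : fm m n = (con (fun i : Fin m => (i : ℕ) + 1) ∅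
    (Finset.univ.filter (fun e : Fin m × Fin m => e.1 ≠ e.2)) n).ncard := by
  rw [fm, ← Nat.card_coe_set_eq]
  refine Nat.card_congr (Equiv.ofBijective
    (fun P => ⟨fun i => P.1.parts.count ((i : ℕ) + 1), ?_⟩) ⟨?_, ?_⟩)
  · obtain ⟨P, h1, h2⟩ := P
    refine ⟨by simp, ?_, ?_⟩
    · rintro ⟨i, j⟩ hij ⟨h3, h4⟩
      have hij : i ≠ j := by simpa using hij
      simp only at h3 h4
      refine h2 (i + 1) (Multiset.count_ne_zero.1 h4) (j + 1)
        (Multiset.count_ne_zero.1 (h3 ▸ h4)) ?_ h3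
      intro h
      exact hij (Fin.ext (by omega))
    · rw [← toM_sum (fun i : Fin m => P.parts.count ((i : ℕ) + 1)),
        toM_of_count P.parts (fun a ha => ⟨P.parts_pos ha, h1 a ha⟩), P.parts_sum]
  · rintro ⟨P, h1, h2⟩ ⟨P', h1', h2'⟩ h
    have h := congrArg toM (congrArg Subtype.val h)
    simp only at h
    rw [toM_of_count P.parts (fun a ha => ⟨P.parts_pos ha, h1 a ha⟩),
      toM_of_count P'.parts (fun a ha => ⟨P'.parts_pos ha, h1' a ha⟩)] at h
    exact Subtype.ext (Nat.Partition.ext h)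
  · rintro ⟨x, _, h1, h2⟩
    refine ⟨⟨⟨toM x, fun {a} ha => ?_, ?_⟩, ?_, ?_⟩, ?_⟩
    · obtain ⟨j, rfl⟩ := toM_mem _ ha
      omega
    · rw [toM_sum, h2]
    · intro a ha
      obtain ⟨j, rfl⟩ := toM_mem _ ha
      omega
    · intro a ha b hb hab h
      obtain ⟨i, rfl⟩ := toM_mem _ ha
      obtain ⟨j, rfl⟩ := toM_mem _ hb
      have ha' := Multiset.count_ne_zero.2 ha
      simp only [toM_count] at h ha'
      exact h1 (i, j) (by simpa using fun h => hab (by rw [h])) ⟨h, ha'⟩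
    · apply Subtype.ext
      funext i
      exact toM_count x i

/-- For each fixed `m ≥ 1`, `f_m(n)` is eventually a quasi-polynomial of degree `m-1` whose
leading coefficient (the coefficient of `n^{m-1}`) is the same nonzero constant `c` on every
residue class: the degree-`(m-1)` part is a genuine polynomial term. -/
theorem fm_quasipolynomial_leading_coeff (m : ℕ) (hm : 1 ≤ m) :
    ∃ (N : ℕ) (_ : 0 < N) (P : ℕ → Polynomial ℚ) (c : ℚ) (n₀ : ℕ),
      c ≠ 0 ∧
      (∀ r < N, (P r).degree ≤ (m - 1 : ℕ) ∧ (P r).coeff (m - 1) = c) ∧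
      ∀ n ≥ n₀, (fm m n : ℚ) = (P (n % N)).eval (n : ℚ) := by
  let w : Fin m → ℕ := fun i => (i : ℕ) + 1
  have hw : ∀ k, 0 < w k := fun k => Nat.succ_pos _
  let a : Fin m := ⟨0, hm⟩
  obtain ⟨c, hc, h⟩ := sol_QP_main w hw a rfl (Finset.univ.erase a) (by simp)
  rw [Finset.insert_erase (Finset.mem_univ a), Finset.card_erase_of_mem (Finset.mem_univ a),
    Finset.card_univ] at h
  have hsc : ∀ n, sol w Finset.univ n = con w ∅ ∅ n := by
    intro n
    ext x
    simp [sol, con]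
  simp only [hsc] at h
  have h2 := con_QP_main w hw c h (Finset.univ.filter (fun e : Fin m × Fin m => e.1 ≠ e.2))
    (by simp)
  simp only [w, ← fm_eq, Fintype.card_fin] at h2
  obtain ⟨N, hN, n₀, hP⟩ := h2
  have hP' : ∀ r : ℕ, ∃ P : Polynomial ℚ, P.natDegree ≤ m - 1 ∧ P.coeff (m - 1) = c ∧
      ∀ k : ℕ, (fm m (n₀ * N + r + k * N) : ℚ) = P.eval ((n₀ * N + r + k * N : ℕ) : ℚ) := by
    intro r
    exact hP (n₀ * N + r) (by nlinarith)
  choose P h1 h2 h3 using hP'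
  refine ⟨N, hN, P, c, n₀ * N, hc,
    fun r _ => ⟨Polynomial.natDegree_le_iff_degree_le.1 (h1 r), h2 r⟩, fun n hn => ?_⟩
  have hq : n₀ ≤ n / N := (Nat.le_div_iff_mul_le hN).2 hn
  have he : n₀ * N + n % N + (n / N - n₀) * N = n := by
    have := Nat.mod_add_div n N
    rw [Nat.sub_mul]
    have : n₀ * N ≤ n / N * N := Nat.mul_le_mul_right _ hq
    have : n / N * N = N * (n / N) := mul_comm _ _
    omega
  have := h3 (n % N) (n / N - n₀)
  rwa [he] at this
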